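/- (Theorem 1, global optimality of p_g = p_data.) Let (X, μ) be a measure space and let p, q : X → ℝ≥0 be measurable probability density functions with respect to μ. Define C(p,q) = ∫ p(x)·log( p(x)/(p(x)+q(x)) ) dμ(x) + ∫ q(x)·log( q(x)/(p(x)+q(x)) ) dμ(x). Then C(p,q) ≥ −log 4, and C(p,q) = −log 4 if and only if p = q μ-almost everywhere. -/

import Mathlib

open MeasureTheory
open scoped NNReal ENNReal

/-- Truncation of an extended real to `ℝ≥0∞` (negatives and `⊥` map to `0`). -/
noncomputable def erealToENNReal (x : EReal) : ℝ≥0∞ :=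
  if x = ⊤ then ⊤ else ENNReal.ofReal x.toReal

/-- Integral of an extended-real-valued function, defined via the positive and
negative parts, with values in the extended reals. -/
noncomputable def eIntegral {X : Type*} [MeasurableSpace X] (μ : Measure X)
    (f : X → EReal) : EReal :=
  ((∫⁻ x, erealToENNReal (f x) ∂μ : ℝ≥0∞) : EReal)
    - ((∫⁻ x, erealToENNReal (-(f x)) ∂μ : ℝ≥0∞) : EReal)

/-- The GAN value function `V(D) = ∫ p·log D dμ + ∫ q·log (1 - D) dμ`, with the
conventions `log 0 = -∞` and `0·(-∞) = 0` (via `ENNReal.log` and `EReal` arithmetic). -/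
noncomputable def V {X : Type*} [MeasurableSpace X] (μ : Measure X)
    (p q : X → ℝ≥0) (D : X → ℝ) : EReal :=
  eIntegral μ (fun x => ((p x : ℝ≥0∞) : EReal) * ENNReal.log (ENNReal.ofReal (D x)))
    + eIntegral μ (fun x => ((q x : ℝ≥0∞) : EReal) * ENNReal.log (ENNReal.ofReal (1 - D x)))

/-- The optimal discriminator `D*(x) = p(x)/(p(x)+q(x))` on `{p+q > 0}`, set to `1/2`
elsewhere. -/
noncomputable def Dstar {X : Type*} (p q : X → ℝ≥0) (x : X) : ℝ :=
  if p x + q x = 0 then 1 / 2 else (p x : ℝ) / ((p x : ℝ) + (q x : ℝ))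

/-- The GAN criterion `C(p,q) = ∫ p·log (p/(p+q)) dμ + ∫ q·log (q/(p+q)) dμ`. -/
noncomputable def Cval {X : Type*} [MeasurableSpace X] (μ : Measure X)
    (p q : X → ℝ≥0) : EReal :=
  eIntegral μ (fun x =>
      ((p x : ℝ≥0∞) : EReal) * ENNReal.log ((p x : ℝ≥0∞) / ((p x : ℝ≥0∞) + (q x : ℝ≥0∞))))
    + eIntegral μ (fun x =>
      ((q x : ℝ≥0∞) : EReal) * ENNReal.log ((q x : ℝ≥0∞) / ((p x : ℝ≥0∞) + (q x : ℝ≥0∞))))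

/-- The Kullback--Leibler divergence `KL(f ‖ g) = ∫ f·log (f/g) dμ` between densities,
with the conventions `0·log (0/g) = 0` and `f·log (f/0) = +∞` for `f > 0`. -/
noncomputable def klDiv {X : Type*} [MeasurableSpace X] (μ : Measure X)
    (f g : X → ℝ≥0) : EReal :=
  eIntegral μ (fun x => ((f x : ℝ≥0∞) : EReal) * ENNReal.log ((f x : ℝ≥0∞) / (g x : ℝ≥0∞)))


lemma erealToENNReal_coe (r : ℝ) : erealToENNReal (r : EReal) = ENNReal.ofReal r := by
  simp [erealToENNReal]

lemma eIntegral_coe {X : Type*} [MeasurableSpace X] {μ : Measure X} {f : X → ℝ}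
    (hf : Integrable f μ) :
    eIntegral μ (fun x => (f x : EReal)) = ((∫ x, f x ∂μ : ℝ) : EReal) := by
  have hpos : ∫⁻ x, ENNReal.ofReal (f x) ∂μ ≠ ⊤ := hf.lintegral_lt_top.ne
  have hneg : ∫⁻ x, ENNReal.ofReal (-f x) ∂μ ≠ ⊤ := hf.neg.lintegral_lt_top.ne
  simp only [eIntegral, ← EReal.coe_neg, erealToENNReal_coe]
  rw [integral_eq_lintegral_pos_part_sub_lintegral_neg_part hf, EReal.coe_sub,
    EReal.coe_ennreal_toReal hpos, EReal.coe_ennreal_toReal hneg]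

lemma coe_mul_log_div_add (a b : ℝ≥0) :
    ((a : ℝ≥0∞) : EReal) * ENNReal.log ((a : ℝ≥0∞) / ((a : ℝ≥0∞) + (b : ℝ≥0∞)))
      = (((a : ℝ) * Real.log ((a : ℝ) / ((a : ℝ) + (b : ℝ))) : ℝ) : EReal) := by
  rcases eq_or_ne a 0 with rfl | ha
  · simp
  · have hab : a + b ≠ 0 := by positivity
    have hdiv : a / (a + b) ≠ 0 := div_ne_zero ha hab
    rw [← ENNReal.coe_add, ← ENNReal.coe_div hab,
      ENNReal.log_pos_real (by exact_mod_cast hdiv) ENNReal.coe_ne_top,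
      EReal.coe_mul, ENNReal.coe_toReal, NNReal.coe_div, NNReal.coe_add]
    rfl

lemma abs_mul_log_div_add_le {a b : ℝ} (ha : 0 ≤ a) (hb : 0 ≤ b) :
    |a * Real.log (a / (a + b))| ≤ b := by
  rcases ha.eq_or_lt with rfl | ha
  · simpa using hb
  have hab : 0 < a + b := by positivity
  have hnonpos : Real.log (a / (a + b)) ≤ 0 :=
    Real.log_nonpos (by positivity) ((div_le_one hab).2 (by linarith))
  have hlog : Real.log ((a + b) / a) ≤ (a + b) / a - 1 :=
    Real.log_le_sub_one_of_pos (by positivity)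
  rw [abs_of_nonpos (mul_nonpos_of_nonneg_of_nonpos ha.le hnonpos), ← mul_neg, ← Real.log_inv,
    inv_div]
  calc a * Real.log ((a + b) / a) ≤ a * ((a + b) / a - 1) := by gcongr
    _ = b := by field_simp; ring

lemma half_sub_lt_mul_log_div_add {a b : ℝ} (ha : 0 ≤ a) (hb : 0 ≤ b) (hne : a ≠ b) :
    (a - b) / 2 < a * Real.log (a / (a + b)) + a * Real.log 2 := by
  rcases ha.eq_or_lt with rfl | ha
  · have : 0 < b := lt_of_le_of_ne hb hne
    rw [zero_mul, zero_mul]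
    linarith
  have hab : 0 < a + b := by positivity
  have hlog : Real.log ((a + b) / (2 * a)) < (a + b) / (2 * a) - 1 := by
    refine Real.log_lt_sub_one_of_pos (by positivity) fun h => hne ?_
    rw [div_eq_one_iff_eq (by positivity)] at h
    linarith
  have hsum : Real.log (a / (a + b)) + Real.log 2 = -Real.log ((a + b) / (2 * a)) := by
    rw [← Real.log_mul (by positivity) (by positivity), ← Real.log_inv, inv_div]
    congr 1
    ring
  have hmul : a * Real.log ((a + b) / (2 * a)) < a * ((a + b) / (2 * a) - 1) := by gcongr
  have hval : a * ((a + b) / (2 * a) - 1) = (b - a) / 2 := by field_simp; ring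
  rw [← mul_add, hsum]
  linarith

lemma mul_log_div_add_self {a : ℝ} : a * Real.log (a / (a + a)) = -(a * Real.log 2) := by
  rcases eq_or_ne a 0 with rfl | ha
  · simp
  · rw [← two_mul, div_mul_cancel_right₀ ha, Real.log_inv, mul_neg]

lemma criterion_integrand_pos {a b : ℝ} (ha : 0 ≤ a) (hb : 0 ≤ b) (hne : a ≠ b) :
    0 < a * Real.log (a / (a + b)) + b * Real.log (b / (b + a)) + (a + b) * Real.log 2 := by
  linarith [half_sub_lt_mul_log_div_add ha hb hne, half_sub_lt_mul_log_div_add hb ha hne.symm]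

lemma criterion_integrand_self (a : ℝ) :
    a * Real.log (a / (a + a)) + a * Real.log (a / (a + a)) + (a + a) * Real.log 2 = 0 := by
  rw [mul_log_div_add_self]
  ring

section Density

variable {X : Type*} [MeasurableSpace X] {μ : Measure X} {p q : X → ℝ≥0}

lemma integrable_density (hp : Measurable p) (hp1 : ∫⁻ x, (p x : ℝ≥0∞) ∂μ = 1) :
    Integrable (fun x => (p x : ℝ)) μ :=
  ⟨hp.coe_nnreal_real.aestronglyMeasurable, by simp [HasFiniteIntegral, enorm, hp1]⟩

lemma integral_density (hp : Measurable p) (hp1 : ∫⁻ x, (p x : ℝ≥0∞) ∂μ = 1) :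
    ∫ x, (p x : ℝ) ∂μ = 1 := by
  rw [integral_eq_lintegral_of_nonneg_ae (.of_forall fun x => (p x).coe_nonneg)
    hp.coe_nnreal_real.aestronglyMeasurable]
  simp [hp1]

lemma integrable_mul_log_div_add (hp : Measurable p) (hq : Measurable q)
    (hq1 : ∫⁻ x, (q x : ℝ≥0∞) ∂μ = 1) :
    Integrable (fun x => (p x : ℝ) * Real.log ((p x : ℝ) / ((p x : ℝ) + (q x : ℝ)))) μ := by
  refine (integrable_density hq hq1).mono' ?_
    (.of_forall fun x => abs_mul_log_div_add_le (p x).coe_nonneg (q x).coe_nonneg)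
  have hp' := hp.coe_nnreal_real
  have hq' := hq.coe_nnreal_real
  exact (hp'.mul (hp'.div (hp'.add hq')).log).aestronglyMeasurable

end Density

/-- **Theorem 1 (global optimality of `p_g = p_data`).** The criterion satisfies
`C(p,q) ≥ -log 4`, with equality if and only if `p = q` `μ`-almost everywhere. -/
theorem criterion_global_optimality {X : Type*} [MeasurableSpace X] (μ : Measure X)
    (p q : X → ℝ≥0) (hp : Measurable p) (hq : Measurable q)
    (hp1 : ∫⁻ x, (p x : ℝ≥0∞) ∂μ = 1) (hq1 : ∫⁻ x, (q x : ℝ≥0∞) ∂μ = 1) :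
    ((-Real.log 4 : ℝ) : EReal) ≤ Cval μ p q
      ∧ (Cval μ p q = ((-Real.log 4 : ℝ) : EReal) ↔ p =ᵐ[μ] q) := by
  set f : X → ℝ := fun x => (p x : ℝ) * Real.log ((p x : ℝ) / ((p x : ℝ) + (q x : ℝ))) with hf
  set g : X → ℝ := fun x => (q x : ℝ) * Real.log ((q x : ℝ) / ((q x : ℝ) + (p x : ℝ))) with hg
  have hfi : Integrable f μ := integrable_mul_log_div_add hp hq hq1
  have hgi : Integrable g μ := integrable_mul_log_div_add hq hp hp1
  have hC : Cval μ p q = ((∫ x, f x ∂μ + ∫ x, g x ∂μ : ℝ) : EReal) := by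
    rw [EReal.coe_add, ← eIntegral_coe hfi, ← eIntegral_coe hgi]
    simp only [Cval, hf, hg, ← coe_mul_log_div_add]
    simp only [add_comm]
  set h : X → ℝ := fun x => f x + g x + ((p x : ℝ) + (q x : ℝ)) * Real.log 2 with hh
  have hpi := integrable_density hp hp1
  have hqi := integrable_density hq hq1
  have hhi : Integrable h μ := (hfi.add hgi).add ((hpi.add hqi).mul_const _)
  have h_eq_zero : ∀ x, p x = q x → h x = 0 := fun x hx => by
    simpa only [hh, hf, hg, hx] using criterion_integrand_self (q x : ℝ)
  have h_pos : ∀ x, p x ≠ q x → 0 < h x := fun x hx =>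
    criterion_integrand_pos (p x).coe_nonneg (q x).coe_nonneg (by exact_mod_cast hx)
  have h_nonneg : 0 ≤ h := fun x => by
    by_cases hx : p x = q x
    · exact (h_eq_zero x hx).ge
    · exact (h_pos x hx).le
  have h_int : ∫ x, h x ∂μ = ∫ x, f x ∂μ + ∫ x, g x ∂μ + Real.log 4 := by
    have hlog : Real.log 4 = 2 * Real.log 2 := by
      rw [show (4 : ℝ) = 2 ^ 2 by norm_num, Real.log_pow]
      norm_num
    have hsplit : ∫ x, h x ∂μ = ∫ x, f x + g x ∂μ + ∫ x, ((p x : ℝ) + q x) * Real.log 2 ∂μ :=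
      integral_add (hfi.add hgi) ((hpi.add hqi).mul_const _)
    rw [hsplit, integral_add hfi hgi, integral_mul_const, integral_add hpi hqi, integral_density hp hp1, integral_density hq hq1,
      hlog]
    norm_num
  have h_iff : ∫ x, h x ∂μ = 0 ↔ p =ᵐ[μ] q := by
    rw [integral_eq_zero_iff_of_nonneg h_nonneg hhi]
    refine Filter.eventually_congr (.of_forall fun x => ⟨fun hx => ?_, h_eq_zero x⟩)
    by_contra hne
    exact (h_pos x hne).ne' hx
  rw [hC, EReal.coe_le_coe_iff, EReal.coe_eq_coe_iff, ← h_iff, h_int]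
  exact ⟨by linarith [integral_nonneg (μ := μ) h_nonneg], eq_neg_iff_add_eq_zero⟩
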